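/- arXiv:2510.21937 — 5 statements merged into one kernel-verified Lean document; each statement's English description precedes it below -/
import Mathlib

section
/- Define T_n : ℝ³ → ℝ recursively by T₀(x,y,z) = 1, T₁(x,y,z) = x, and T_n(x,y,z) = ((2n−1)/n)·x·T_{n−1}(x,y,z) − ((n−1)/n)·(x²+y²+z²)·T_{n−2}(x,y,z) for n ≥ 2. Then for every d > 0 and every (x,y,z) ∈ ℝ³ with x² + y² + z² < d², the series ∑_{n=0}^∞ T_n(x,y,z)/d^{n+1} converges absolutely and its sum equals ((x−d)² + y² + z²)^{−1/2}. -/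
/-- The functions `T_n(x,y,z) = ρⁿ 𝒫_n(x/ρ)` defined by the Legendre recursion
`T₀ = 1`, `T₁ = x`, `T_n = ((2n−1)/n) x T_{n−1} − ((n−1)/n)(x²+y²+z²) T_{n−2}`. -/
noncomputable def legendreT (x y z : ℝ) : ℕ → ℝ
  | 0 => 1
  | 1 => x
  | n + 2 =>
      ((2 * ((n : ℝ) + 2) - 1) / ((n : ℝ) + 2)) * x * legendreT x y z (n + 1)
        - (((n : ℝ) + 1) / ((n : ℝ) + 2)) * (x ^ 2 + y ^ 2 + z ^ 2) * legendreT x y z n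

/-- The formal power series of `(1 - a X)^{-1/2}`. -/
noncomputable def invSqrtSeries (a : ℂ) : PowerSeries ℂ :=
  PowerSeries.mk fun k => (k.centralBinom : ℂ) / 4 ^ k * a ^ k

open PowerSeries in
lemma one_sub_mul_derivative_invSqrtSeries (a : ℂ) :
    2 * (1 - C a * X) * d⁄dX ℂ (invSqrtSeries a) = C a * invSqrtSeries a := by
  have coeff_rec (n : ℕ) : 2 * (((n + 1).centralBinom : ℂ) / 4 ^ (n + 1) * a ^ (n + 1) * (n + 1))
      = (2 * n + 1) * a * ((n.centralBinom : ℂ) / 4 ^ n * a ^ n) := by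
    have h : ((n : ℂ) + 1) * (n + 1).centralBinom = 2 * (2 * n + 1) * n.centralBinom := by
      exact_mod_cast Nat.succ_mul_centralBinom_succ n
    rw [pow_succ, pow_succ]
    linear_combination a ^ n * a / (2 * 4 ^ n) * h
  have expand : 2 * (1 - C a * X) * d⁄dX ℂ (invSqrtSeries a)
      = C 2 * d⁄dX ℂ (invSqrtSeries a) - C (2 * a) * (X * d⁄dX ℂ (invSqrtSeries a)) := by
    rw [map_mul, map_ofNat]
    ring
  rw [expand]
  ext n
  rw [map_sub, coeff_C_mul, coeff_C_mul, coeff_C_mul, coeff_derivative]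
  cases n with
  | zero =>
    have h := coeff_rec 0
    simp only [invSqrtSeries, coeff_mk, coeff_zero_X_mul]
    linear_combination h
  | succ n =>
    have h := coeff_rec (n + 1)
    rw [coeff_succ_X_mul, coeff_derivative]
    simp only [invSqrtSeries, coeff_mk]
    push_cast at h ⊢
    linear_combination h

open PowerSeries in
lemma derivative_invSqrtSeries_mul (a b : ℂ) :
    2 * (1 - C (a + b) * X + C (a * b) * X ^ 2) *
        d⁄dX ℂ (invSqrtSeries a * invSqrtSeries b)
      = (C (a + b) - 2 * C (a * b) * X) * (invSqrtSeries a * invSqrtSeries b) := by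
  have ha := one_sub_mul_derivative_invSqrtSeries a
  have hb := one_sub_mul_derivative_invSqrtSeries b
  rw [Derivation.leibniz, smul_eq_mul, smul_eq_mul, map_add, map_mul]
  linear_combination (1 - C b * X) * invSqrtSeries b * ha
    + (1 - C a * X) * invSqrtSeries a * hb

open PowerSeries in
lemma coeff_zero_invSqrtSeries_mul (a b : ℂ) :
    coeff 0 (invSqrtSeries a * invSqrtSeries b) = 1 := by
  rw [coeff_mul]
  simp [invSqrtSeries]

open PowerSeries in
lemma coeff_one_invSqrtSeries_mul (a b : ℂ) :
    coeff 1 (invSqrtSeries a * invSqrtSeries b) = (a + b) / 2 := by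
  rw [coeff_mul, Finset.Nat.antidiagonal_succ]
  simp [invSqrtSeries, Nat.centralBinom]
  ring

open PowerSeries in
/-- The Legendre recursion for the coefficients of `((1 - a X)(1 - b X))^{-1/2}`. -/
lemma coeff_invSqrtSeries_mul_recursion (a b : ℂ) (n : ℕ) :
    ((n : ℂ) + 2) * coeff (n + 2) (invSqrtSeries a * invSqrtSeries b)
      = (2 * n + 3) * ((a + b) / 2) * coeff (n + 1) (invSqrtSeries a * invSqrtSeries b)
        - (n + 1) * (a * b) * coeff n (invSqrtSeries a * invSqrtSeries b) := by
  have h := derivative_invSqrtSeries_mul a b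
  generalize invSqrtSeries a * invSqrtSeries b = G at h ⊢
  have h' : C 2 * d⁄dX ℂ G - C (2 * (a + b)) * (X * d⁄dX ℂ G)
      + C (2 * (a * b)) * (X * (X * d⁄dX ℂ G)) = C (a + b) * G - C (2 * (a * b)) * (X * G) := by
    rw [map_mul C 2, map_mul C 2, map_ofNat]
    linear_combination h
  have hn := congrArg (coeff (n + 1)) h'
  simp only [map_add, map_sub, coeff_C_mul, coeff_succ_X_mul, coeff_derivative] at hn
  have hX : coeff n (X * d⁄dX ℂ G) = n * coeff n G := by
    cases n with
    | zero => simp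
    | succ m => rw [coeff_succ_X_mul, coeff_derivative]; push_cast; ring
  simp only [← map_add, coeff_C_mul, hX] at hn
  push_cast at hn
  linear_combination hn / 2

open PowerSeries in
lemma coeff_invSqrtSeries_mul_self (a : ℂ) (n : ℕ) :
    coeff n (invSqrtSeries a * invSqrtSeries a) = a ^ n := by
  induction n using Nat.twoStepInduction with
  | zero => simpa using coeff_zero_invSqrtSeries_mul a a
  | one => simpa using coeff_one_invSqrtSeries_mul a a
  | more n ih₀ ih₁ =>
    have h := coeff_invSqrtSeries_mul_recursion a a n
    have hn : (n : ℂ) + 2 ≠ 0 := by exact_mod_cast (n + 1).succ_ne_zero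
    rw [ih₀, ih₁] at h
    apply mul_left_cancel₀ hn
    rw [h]
    ring

open PowerSeries in
lemma coeff_invSqrtSeries_mul_eq_legendreT {a b : ℂ} {x y z : ℝ} (hadd : a + b = 2 * x)
    (hmul : a * b = x ^ 2 + y ^ 2 + z ^ 2) (n : ℕ) :
    coeff n (invSqrtSeries a * invSqrtSeries b) = legendreT x y z n := by
  induction n using Nat.twoStepInduction with
  | zero => simpa [legendreT] using coeff_zero_invSqrtSeries_mul a b
  | one => simpa [legendreT, hadd] using coeff_one_invSqrtSeries_mul a b
  | more n ih₀ ih₁ =>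
    have h := coeff_invSqrtSeries_mul_recursion a b n
    have hn : (n : ℂ) + 2 ≠ 0 := by exact_mod_cast (n + 1).succ_ne_zero
    rw [ih₀, ih₁, hadd, hmul] at h
    apply mul_left_cancel₀ hn
    rw [h, legendreT]
    push_cast
    field_simp
    ring

open PowerSeries in
lemma summable_norm_invSqrtSeries {a t : ℂ} (h : ‖a * t‖ < 1) :
    Summable fun n => ‖coeff n (invSqrtSeries a) * t ^ n‖ := by
  refine Summable.of_nonneg_of_le (fun _ => norm_nonneg _) (fun n => ?_)
    (summable_geometric_of_lt_one (norm_nonneg _) h)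
  have hc : ((n.centralBinom : ℝ) / 4 ^ n) ≤ 1 :=
    div_le_one_of_le₀ (by exact_mod_cast n.centralBinom_le_four_pow) (by positivity)
  simp only [invSqrtSeries, coeff_mk, mul_assoc, ← mul_pow]
  rw [norm_mul, norm_pow]
  refine mul_le_of_le_one_left (by positivity) ?_
  simpa using hc

open PowerSeries in
lemma PowerSeries.sum_antidiagonal_coeff_mul_pow (F G : PowerSeries ℂ) (t : ℂ) (n : ℕ) :
    ∑ p ∈ Finset.HasAntidiagonal.antidiagonal n, (coeff p.1 F * t ^ p.1) * (coeff p.2 G * t ^ p.2)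
      = coeff n (F * G) * t ^ n := by
  rw [coeff_mul, Finset.sum_mul]
  refine Finset.sum_congr rfl fun p hp => ?_
  rw [← Finset.HasAntidiagonal.mem_antidiagonal.mp hp, pow_add]
  ring

open PowerSeries in
lemma tsum_invSqrtSeries_sq {a t : ℂ} (h : ‖a * t‖ < 1) :
    (∑' n, coeff n (invSqrtSeries a) * t ^ n) ^ 2 = (1 - a * t)⁻¹ := by
  have hs := summable_norm_invSqrtSeries h
  rw [sq, tsum_mul_tsum_eq_tsum_sum_antidiagonal_of_summable_norm hs hs,
    ← tsum_geometric_of_norm_lt_one h]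
  simp only [sum_antidiagonal_coeff_mul_pow, coeff_invSqrtSeries_mul_self, mul_pow]

open PowerSeries ComplexConjugate in
lemma tsum_invSqrtSeries_conj (a : ℂ) (t : ℝ) :
    ∑' n, coeff n (invSqrtSeries (conj a)) * (t : ℂ) ^ n
      = conj (∑' n, coeff n (invSqrtSeries a) * (t : ℂ) ^ n) := by
  rw [Complex.conj_tsum]
  simp [invSqrtSeries, Complex.conj_ofNat]

/-- For `d > 0` and `x² + y² + z² < d²`, the series `∑ T_n(x,y,z)/d^{n+1}` converges
absolutely and its sum is `((x−d)² + y² + z²)^{−1/2}`. -/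
theorem legendreT_series_inverse_distance
    (d x y z : ℝ) (hd : 0 < d) (h : x ^ 2 + y ^ 2 + z ^ 2 < d ^ 2) :
    Summable (fun n : ℕ => |legendreT x y z n / d ^ (n + 1)|) ∧
    HasSum (fun n : ℕ => legendreT x y z n / d ^ (n + 1))
      (1 / Real.sqrt ((x - d) ^ 2 + y ^ 2 + z ^ 2)) := by
  set a : ℂ := ⟨x, Real.sqrt (y ^ 2 + z ^ 2)⟩ with ha
  set b : ℂ := starRingEnd ℂ a with hb
  set t : ℝ := d⁻¹ with ht
  have hsqrt : Real.sqrt (y ^ 2 + z ^ 2) ^ 2 = y ^ 2 + z ^ 2 := Real.sq_sqrt (by positivity)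
  have hadd : a + b = 2 * x := by
    rw [hb, Complex.add_conj]
    simp [ha]
  have hmul : a * b = x ^ 2 + y ^ 2 + z ^ 2 := by
    rw [hb, Complex.mul_conj, Complex.normSq_apply, ← sq, ← sq, hsqrt]
    push_cast
    ring
  have hnorm_a : ‖a‖ < d := by
    rw [← sq_lt_sq₀ (norm_nonneg _) hd.le, ← Complex.normSq_eq_norm_sq, Complex.normSq_apply,
      ← sq, ← sq, hsqrt]
    linarith
  have hat : ‖a * t‖ < 1 := by
    rw [norm_mul, Complex.norm_real, Real.norm_of_nonneg (by positivity), ht, ← div_eq_mul_inv]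
    exact (div_lt_one hd).mpr hnorm_a
  have hbt : ‖b * t‖ < 1 := by simpa [hb] using hat
  have hsa := summable_norm_invSqrtSeries hat
  have hsb := summable_norm_invSqrtSeries hbt
  have hterm (n : ℕ) : ∑ p ∈ Finset.HasAntidiagonal.antidiagonal n,
      (PowerSeries.coeff p.1 (invSqrtSeries a) * (t : ℂ) ^ p.1) *
        (PowerSeries.coeff p.2 (invSqrtSeries b) * (t : ℂ) ^ p.2)
      = ((legendreT x y z n * t ^ n : ℝ) : ℂ) := by
    rw [PowerSeries.sum_antidiagonal_coeff_mul_pow,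
      coeff_invSqrtSeries_mul_eq_legendreT hadd hmul]
    push_cast
    rfl
  have hsummable : Summable fun n => |legendreT x y z n * t ^ n| := by
    have := summable_norm_sum_mul_antidiagonal_of_summable_norm hsa hsb
    simpa only [hterm, Complex.norm_real, Real.norm_eq_abs] using this
  set f : ℂ := ∑' n, PowerSeries.coeff n (invSqrtSeries a) * (t : ℂ) ^ n with hf
  have hsum : ∑' n, legendreT x y z n * t ^ n = Complex.normSq f := by
    have := tsum_mul_tsum_eq_tsum_sum_antidiagonal_of_summable_norm hsa hsb
    simp only [hterm] at this
    rw [← Complex.ofReal_tsum, hb, tsum_invSqrtSeries_conj, ← hf, Complex.mul_conj] at this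
    exact_mod_cast this.symm
  have hnormSq : Complex.normSq (1 - a * t) = ((x - d) ^ 2 + y ^ 2 + z ^ 2) * t ^ 2 := by
    have htd : d * t = 1 := mul_inv_cancel₀ hd.ne'
    rw [Complex.normSq_apply]
    simp only [ha, Complex.sub_re, Complex.sub_im, Complex.one_re, Complex.one_im, Complex.mul_re,
      Complex.mul_im, Complex.ofReal_re, Complex.ofReal_im]
    linear_combination t ^ 2 * hsqrt + (2 * x * t - d * t - 1) * htd
  have hvalue : Complex.normSq f * t = 1 / Real.sqrt ((x - d) ^ 2 + y ^ 2 + z ^ 2) := by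
    have hsq : Complex.normSq f ^ 2 = (((x - d) ^ 2 + y ^ 2 + z ^ 2) * t ^ 2)⁻¹ := by
      rw [← map_pow, tsum_invSqrtSeries_sq hat, map_inv₀, hnormSq]
    have htpos : 0 < t := inv_pos.mpr hd
    rw [one_div, ← Real.sqrt_inv, eq_comm, Real.sqrt_eq_iff_eq_sq (by positivity)
      (mul_nonneg (Complex.normSq_nonneg _) htpos.le), mul_pow, hsq, mul_inv,
      inv_mul_cancel_right₀ (by positivity)]
  have hdiv : (fun n : ℕ => legendreT x y z n / d ^ (n + 1))
      = fun n => legendreT x y z n * t ^ n * t := by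
    funext n
    rw [div_eq_mul_inv, ← inv_pow, pow_succ, mul_assoc]
  have hhas : HasSum (fun n : ℕ => legendreT x y z n / d ^ (n + 1))
      (1 / Real.sqrt ((x - d) ^ 2 + y ^ 2 + z ^ 2)) := by
    rw [hdiv, ← hvalue, ← hsum]
    exact hsummable.of_abs.hasSum.mul_right t
  exact ⟨hhas.summable.abs, hhas⟩
end

section
/- Let c₂ > 1, set η₁ = (c₂ − 2 − √(9c₂² − 8c₂))/2 and η₂ = (c₂ − 2 + √(9c₂² − 8c₂))/2, and let λ_x = √η₂, ω_y = √(−η₁). Then the set of complex eigenvalues of the 4×4 matrix M with rows (0,1,1,0), (−1,0,0,1), (2c₂,0,0,1), (0,−c₂,−1,0), regarded as a matrix over ℂ, is exactly {λ_x, −λ_x, i·ω_y, −i·ω_y}. -/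
/-- The characteristic polynomial of the linearization at a collinear point is biquadratic. -/
lemma det_linearized_collinear (c z : ℂ) :
    (z • (1 : Matrix (Fin 4) (Fin 4) ℂ) -
        !![0, 1, 1, 0; -1, 0, 0, 1; 2 * c, 0, 0, 1; 0, -c, -1, 0]).det
      = z ^ 4 + (2 - c) * z ^ 2 + (1 + c - 2 * c ^ 2) := by
  simp [Matrix.det_succ_row_zero, Fin.sum_univ_succ, Fin.succAbove, Matrix.one_apply]
  ring

/-- For `c₂ > 1`, with `λ_x = √η₂` and `ω_y = √(−η₁)`, the set of complex eigenvalues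
of the linearization matrix `M` (rows `(0,1,1,0)`, `(−1,0,0,1)`, `(2c₂,0,0,1)`,
`(0,−c₂,−1,0)`) is exactly `{λ_x, −λ_x, i ω_y, −i ω_y}`. -/
theorem eigenvalues_linearized_collinear
    (c₂ η₁ η₂ lx ωy : ℝ) (hc : 1 < c₂)
    (hη₁ : η₁ = (c₂ - 2 - Real.sqrt (9 * c₂ ^ 2 - 8 * c₂)) / 2)
    (hη₂ : η₂ = (c₂ - 2 + Real.sqrt (9 * c₂ ^ 2 - 8 * c₂)) / 2)
    (hlx : lx = Real.sqrt η₂) (hωy : ωy = Real.sqrt (-η₁)) :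
    {z : ℂ | (z • (1 : Matrix (Fin 4) (Fin 4) ℂ) -
        !![0, 1, 1, 0; -1, 0, 0, 1; 2 * (c₂ : ℂ), 0, 0, 1; 0, -(c₂ : ℂ), -1, 0]).det = 0}
      = {(lx : ℂ), -(lx : ℂ), Complex.I * (ωy : ℂ), -(Complex.I * (ωy : ℂ))} := by
  have hs := Real.sq_sqrt (show 0 ≤ 9 * c₂ ^ 2 - 8 * c₂ by nlinarith)
  have hs0 := Real.sqrt_nonneg (9 * c₂ ^ 2 - 8 * c₂)
  set s := Real.sqrt (9 * c₂ ^ 2 - 8 * c₂)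
  have habs : |c₂ - 2| < s := abs_lt_of_sq_lt_sq (by nlinarith) hs0
  obtain ⟨hl, hr⟩ := abs_lt.mp habs
  have hlx2 : lx ^ 2 = η₂ := by rw [hlx, Real.sq_sqrt (by linarith)]
  have hωy2 : ωy ^ 2 = -η₁ := by rw [hωy, Real.sq_sqrt (by linarith)]
  have hsum : lx ^ 2 - ωy ^ 2 = c₂ - 2 := by rw [hlx2, hωy2]; linarith
  have hprod : lx ^ 2 * ωy ^ 2 = 2 * c₂ ^ 2 - c₂ - 1 := by
    rw [hlx2, hωy2, hη₁, hη₂]; linear_combination hs / 4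
  have hsumC : (lx : ℂ) ^ 2 - (ωy : ℂ) ^ 2 = c₂ - 2 := by exact_mod_cast hsum
  have hprodC : (lx : ℂ) ^ 2 * (ωy : ℂ) ^ 2 = 2 * (c₂ : ℂ) ^ 2 - c₂ - 1 := by
    exact_mod_cast hprod
  ext z
  have hfactor : z ^ 4 + (2 - (c₂ : ℂ)) * z ^ 2 + (1 + c₂ - 2 * (c₂ : ℂ) ^ 2)
      = (z - lx) * (z + lx) * ((z - Complex.I * ωy) * (z + Complex.I * ωy)) := by
    linear_combination z ^ 2 * hsumC + hprodC
      + (ωy : ℂ) ^ 2 * (z ^ 2 - (lx : ℂ) ^ 2) * Complex.I_sq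
  rw [Set.mem_ofPred_eq, det_linearized_collinear, hfactor]
  simp only [Set.mem_insert_iff, Set.mem_singleton_iff, mul_eq_zero, sub_eq_zero,
    add_eq_zero_iff_eq_neg, or_assoc]
end

section
/- Let c₂ > 1, set η₁ = (c₂ − 2 − √(9c₂² − 8c₂))/2 and η₂ = (c₂ − 2 + √(9c₂² − 8c₂))/2, and let λ_x = √η₂, ω_y = √(−η₁). Then there exists a real 4×4 symplectic matrix C (i.e. Cᵀ J C = J, where J is the standard symplectic matrix pairing the coordinates (x,y) with the momenta (p_x,p_y)) such that for all (x̃, ỹ, p̃_x, p̃_y) ∈ ℝ⁴, H₀(C·(x̃, ỹ, p̃_x, p̃_y)) = λ_x x̃ p̃_x + (ω_y/2)(ỹ² + p̃_y²), where H₀(x,y,p_x,p_y) = ½(p_x² + p_y²) + y p_x − x p_y − c₂ x² + ½ c₂ y². -/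
/-- The planar quadratic Hamiltonian at a collinear Lagrangian point, in the
coordinates `w = (x, y, p_x, p_y)`:
`H₀ = ½(p_x² + p_y²) + y p_x − x p_y − c₂ x² + ½ c₂ y²`. -/
noncomputable def H0quad (c₂ : ℝ) (w : Fin 4 → ℝ) : ℝ :=
  (1 / 2) * ((w 2) ^ 2 + (w 3) ^ 2) + w 1 * w 2 - w 0 * w 3
    - c₂ * (w 0) ^ 2 + (1 / 2) * c₂ * (w 1) ^ 2

/-- The standard symplectic matrix pairing the coordinates `(x, y)` with the
momenta `(p_x, p_y)`. -/
def Jstd : Matrix (Fin 4) (Fin 4) ℝ :=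
  !![0, 0, 1, 0; 0, 0, 0, 1; -1, 0, 0, 0; 0, -1, 0, 0]

theorem exists_sq_mul_eq_one {d : ℝ} (hd : 0 < d) : ∃ a : ℝ, a ^ 2 * d = 1 :=
  ⟨(Real.sqrt d)⁻¹, by rw [inv_pow, Real.sq_sqrt hd.le, inv_mul_cancel₀ (ne_of_gt hd)]⟩

/-- The saddle directions are spanned by the eigenvectors for `±l`, the center directions by the
real and imaginary parts of the eigenvector for `i * w`; all are rescaled to be symplectic. -/
theorem exists_symplectic_of_frequencies {c l w : ℝ} (hc : 1 < c) (hl : 0 < l) (hw : 0 < w)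
    (hdiff : w ^ 2 = l ^ 2 - c + 2)
    (hchar : l ^ 4 = (c - 2) * l ^ 2 + (2 * c + 1) * (c - 1))
    (hlow : 2 * c - 2 < l ^ 2) :
    ∃ C : Matrix (Fin 4) (Fin 4) ℝ,
      C.transpose * Jstd * C = Jstd ∧
      ∀ v : Fin 4 → ℝ,
        H0quad c (C.mulVec v) = l * (v 0 * v 2) + (w / 2) * ((v 1) ^ 2 + (v 3) ^ 2) := by
  have hposl : 0 < 2 * l * ((3 * c + 4) * l ^ 2 + 4 + 5 * c - 6 * c ^ 2) := by
    have : 0 < (3 * c + 4) * l ^ 2 + 4 + 5 * c - 6 * c ^ 2 := by nlinarith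
    positivity
  have hposw : 0 < w * ((3 * c + 4) * w ^ 2 - 4 - 5 * c + 6 * c ^ 2) := by
    have : 0 < (3 * c + 4) * w ^ 2 - 4 - 5 * c + 6 * c ^ 2 := by nlinarith
    positivity
  obtain ⟨a, ha⟩ : ∃ a : ℝ, a ^ 2 * (2 * l * ((3 * c + 4) * l ^ 2 + 4 + 5 * c - 6 * c ^ 2)) = 1 :=
    exists_sq_mul_eq_one hposl
  obtain ⟨b, hb⟩ : ∃ b : ℝ, b ^ 2 * (w * ((3 * c + 4) * w ^ 2 - 4 - 5 * c + 6 * c ^ 2)) = 1 :=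
    exists_sq_mul_eq_one hposw
  refine ⟨!![2 * l * a, 0, -2 * l * a, 2 * w * b;
    (l ^ 2 - 2 * c - 1) * a, (-w ^ 2 - 2 * c - 1) * b, (l ^ 2 - 2 * c - 1) * a, 0;
    (l ^ 2 + 2 * c + 1) * a, (-w ^ 2 + 2 * c + 1) * b, (l ^ 2 + 2 * c + 1) * a, 0;
    (l ^ 3 + (1 - 2 * c) * l) * a, 0, -(l ^ 3 + (1 - 2 * c) * l) * a,
      (-w ^ 3 + (1 - 2 * c) * w) * b], ?_, ?_⟩
  · ext i j
    fin_cases i <;> fin_cases j <;>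
      simp [Jstd, Matrix.mul_apply, Fin.sum_univ_four] <;> grind
  · intro v
    simp only [H0quad, Matrix.mulVec, dotProduct, Fin.sum_univ_four]
    simp only [Matrix.of_apply, Matrix.cons_val]
    have hss : a ^ 2 * ((l ^ 2 + 2 * c + 1) ^ 2 + 2 * (l ^ 2 + 2 * c + 1) * (l ^ 2 - 2 * c - 1)
        + c * (l ^ 2 - 2 * c - 1) ^ 2) = l / 2 := by grind
    have hsy : (l ^ 2 + 2 * c + 1) * (-w ^ 2 + 2 * c + 1) + (l ^ 2 - 2 * c - 1) * (-w ^ 2 + 2 * c + 1)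
        + (l ^ 2 + 2 * c + 1) * (-w ^ 2 - 2 * c - 1) + c * (l ^ 2 - 2 * c - 1) * (-w ^ 2 - 2 * c - 1) = 0 := by
      grind
    have hyy : b ^ 2 * ((-w ^ 2 + 2 * c + 1) ^ 2 + 2 * (-w ^ 2 - 2 * c - 1) * (-w ^ 2 + 2 * c + 1)
        + c * (-w ^ 2 - 2 * c - 1) ^ 2) = w := by grind
    have htt : a ^ 2 * ((l ^ 3 + (1 - 2 * c) * l) ^ 2 - 4 * l * (l ^ 3 + (1 - 2 * c) * l)
        - 8 * c * l ^ 2) = -l / 2 := by grind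
    have htq : (l ^ 3 + (1 - 2 * c) * l) * (-w ^ 3 + (1 - 2 * c) * w) - 2 * l * (-w ^ 3 + (1 - 2 * c) * w)
        - 2 * w * (l ^ 3 + (1 - 2 * c) * l) - 8 * c * l * w = 0 := by grind
    have hqq : b ^ 2 * ((-w ^ 3 + (1 - 2 * c) * w) ^ 2 - 4 * w * (-w ^ 3 + (1 - 2 * c) * w)
        - 8 * c * w ^ 2) = w := by grind
    linear_combination (v 0 + v 2) ^ 2 / 2 * hss + a * b * (v 0 + v 2) * v 1 * hsy
      + v 1 ^ 2 / 2 * hyy + (v 0 - v 2) ^ 2 / 2 * htt + a * b * (v 0 - v 2) * v 3 * htq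
      + v 3 ^ 2 / 2 * hqq

/-- For `c₂ > 1` there exists a real symplectic matrix `C` (i.e. `Cᵀ J C = J`)
diagonalising `H₀` into `λ_x x̃ p̃_x + (ω_y/2)(ỹ² + p̃_y²)`. -/
theorem exists_symplectic_diagonalisation
    (c₂ η₁ η₂ lx ωy : ℝ) (hc : 1 < c₂)
    (hη₁ : η₁ = (c₂ - 2 - Real.sqrt (9 * c₂ ^ 2 - 8 * c₂)) / 2)
    (hη₂ : η₂ = (c₂ - 2 + Real.sqrt (9 * c₂ ^ 2 - 8 * c₂)) / 2)
    (hlx : lx = Real.sqrt η₂) (hωy : ωy = Real.sqrt (-η₁)) :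
    ∃ C : Matrix (Fin 4) (Fin 4) ℝ,
      C.transpose * Jstd * C = Jstd ∧
      ∀ v : Fin 4 → ℝ,
        H0quad c₂ (C.mulVec v)
          = lx * (v 0 * v 2) + (ωy / 2) * ((v 1) ^ 2 + (v 3) ^ 2) := by
  have hD : 0 ≤ 9 * c₂ ^ 2 - 8 * c₂ := by nlinarith
  have hsq := Real.sq_sqrt hD
  have hlt : 3 * c₂ - 2 < Real.sqrt (9 * c₂ ^ 2 - 8 * c₂) :=
    Real.lt_sqrt_of_sq_lt (by nlinarith)
  have hlx2 : lx ^ 2 = η₂ := by rw [hlx]; exact Real.sq_sqrt (by linarith)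
  have hωy2 : ωy ^ 2 = -η₁ := by rw [hωy]; exact Real.sq_sqrt (by linarith)
  have hlx0 : 0 < lx := by rw [hlx]; exact Real.sqrt_pos.2 (by linarith)
  have hωy0 : 0 < ωy := by rw [hωy]; exact Real.sqrt_pos.2 (by linarith)
  have hdiff : ωy ^ 2 = lx ^ 2 - c₂ + 2 := by linarith
  have hchar : lx ^ 4 = (c₂ - 2) * lx ^ 2 + (2 * c₂ + 1) * (c₂ - 1) := by
    have : lx ^ 4 = η₂ ^ 2 := by rw [← hlx2]; ring
    rw [this, hlx2, hη₂]
    linear_combination hsq / 4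
  have hlow : 2 * c₂ - 2 < lx ^ 2 := by linarith
  exact exists_symplectic_of_frequencies hc hlx0 hωy0 hdiff hchar hlow
end

section
/- Let Ω_z, δ, a, b, c, d be real constants with a ≠ d, and consider the Hamiltonian K^(tr)(ℰ, ℛ, ν, ψ) = Ω_z ℰ + δ ℛ + a ℛ² + b ℰ² + c ℰ ℛ + d(ℛ² − ℰ ℛ) cos(2ψ) with conjugate pairs (ℰ, ν) and (ℛ, ψ). Fix ℰ₀ ∈ ℝ and set ℛ_eq = (δ + (c + d)ℰ₀)/(2(d − a)) and Ω_H = Ω_z + 2b ℰ₀ + (c + d)ℛ_eq. Then for any ν₀, the curve t ↦ (ℰ(t), ℛ(t), ν(t), ψ(t)) = (ℰ₀, ℛ_eq, ν₀ + Ω_H t, π/2) solves Hamilton's equations ℰ' = −∂K^(tr)/∂ν, ℛ' = −∂K^(tr)/∂ψ, ν' = ∂K^(tr)/∂ℰ, ψ' = ∂K^(tr)/∂ℛ. -/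
/-- The transformed center-manifold normal form
`K^(tr)(ℰ, ℛ, ν, ψ) = Ω_z ℰ + δ ℛ + a ℛ² + b ℰ² + c ℰ ℛ + d(ℛ² − ℰ ℛ) cos(2ψ)`. -/
noncomputable def Ktr (Ωz δ a b c d E R ν ψ : ℝ) : ℝ :=
  Ωz * E + δ * R + a * R ^ 2 + b * E ^ 2 + c * E * R
    + d * (R ^ 2 - E * R) * Real.cos (2 * ψ)

theorem hasDerivAt_Ktr_E (Ωz δ a b c d E R ν ψ : ℝ) :
    HasDerivAt (fun E : ℝ => Ktr Ωz δ a b c d E R ν ψ)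
      (Ωz + 2 * b * E + c * R - d * R * Real.cos (2 * ψ)) E := by
  have hE := hasDerivAt_id' E
  unfold Ktr
  refine ((((((hE.const_mul Ωz).add_const (δ * R)).add_const (a * R ^ 2)).add
    ((hE.pow 2).const_mul b)).add ((hE.const_mul c).mul_const R)).add
    ((((hE.mul_const R).const_sub (R ^ 2)).const_mul d).mul_const
      (Real.cos (2 * ψ)))).congr_deriv ?_
  push_cast
  ring

theorem hasDerivAt_Ktr_R (Ωz δ a b c d E R ν ψ : ℝ) :
    HasDerivAt (fun R : ℝ => Ktr Ωz δ a b c d E R ν ψ)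
      (δ + 2 * a * R + c * E + d * (2 * R - E) * Real.cos (2 * ψ)) R := by
  have hR := hasDerivAt_id' R
  unfold Ktr
  refine ((((((hR.const_mul δ).const_add (Ωz * E)).add ((hR.pow 2).const_mul a)).add_const
    (b * E ^ 2)).add (hR.const_mul (c * E))).add
    ((((hR.pow 2).sub (hR.const_mul E)).const_mul d).mul_const
      (Real.cos (2 * ψ)))).congr_deriv ?_
  push_cast
  ring

theorem hasDerivAt_Ktr_ν (Ωz δ a b c d E R ν ψ : ℝ) :
    HasDerivAt (fun ν : ℝ => Ktr Ωz δ a b c d E R ν ψ) 0 ν :=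
  hasDerivAt_const _ _

theorem hasDerivAt_Ktr_ψ (Ωz δ a b c d E R ν ψ : ℝ) :
    HasDerivAt (fun ψ : ℝ => Ktr Ωz δ a b c d E R ν ψ)
      (-(2 * d * (R ^ 2 - E * R) * Real.sin (2 * ψ))) ψ := by
  unfold Ktr
  refine ((((hasDerivAt_id' ψ).const_mul 2).cos.const_mul
    (d * (R ^ 2 - E * R))).const_add _).congr_deriv ?_
  ring

/-- The halo (loop) relative equilibrium: with `ℛ_eq = (δ + (c + d)ℰ₀)/(2(d − a))`
and `Ω_H = Ω_z + 2bℰ₀ + (c + d)ℛ_eq`, the curve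
`t ↦ (ℰ₀, ℛ_eq, ν₀ + Ω_H t, π/2)` solves Hamilton's equations of `K^(tr)`. -/
theorem halo_relative_equilibrium_solves_hamilton
    (Ωz δ a b c d : ℝ) (had : a ≠ d) (E₀ ν₀ Req ΩH : ℝ)
    (hReq : Req = (δ + (c + d) * E₀) / (2 * (d - a)))
    (hΩH : ΩH = Ωz + 2 * b * E₀ + (c + d) * Req) :
    ∀ t : ℝ,
      HasDerivAt (fun _ : ℝ => E₀)
        (-(deriv (fun ν : ℝ => Ktr Ωz δ a b c d E₀ Req ν (Real.pi / 2))
            (ν₀ + ΩH * t))) t ∧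
      HasDerivAt (fun _ : ℝ => Req)
        (-(deriv (fun ψ : ℝ => Ktr Ωz δ a b c d E₀ Req (ν₀ + ΩH * t) ψ)
            (Real.pi / 2))) t ∧
      HasDerivAt (fun s : ℝ => ν₀ + ΩH * s)
        (deriv (fun E : ℝ => Ktr Ωz δ a b c d E Req (ν₀ + ΩH * t) (Real.pi / 2)) E₀) t ∧
      HasDerivAt (fun _ : ℝ => Real.pi / 2)
        (deriv (fun R : ℝ => Ktr Ωz δ a b c d E₀ R (ν₀ + ΩH * t) (Real.pi / 2)) Req) t := by
  intro t
  have hψ : 2 * (Real.pi / 2) = Real.pi := by ring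
  rw [(hasDerivAt_Ktr_ν ..).deriv, (hasDerivAt_Ktr_ψ ..).deriv, (hasDerivAt_Ktr_E ..).deriv,
    (hasDerivAt_Ktr_R ..).deriv, hψ, Real.sin_pi, Real.cos_pi]
  refine ⟨(hasDerivAt_const t E₀).congr_deriv (by simp),
    (hasDerivAt_const t Req).congr_deriv (by simp),
    (((hasDerivAt_id' t).const_mul ΩH).const_add ν₀).congr_deriv ?_,
    (hasDerivAt_const t _).congr_deriv ?_⟩
  · rw [hΩH]
    ring
  · have hda : 2 * (d - a) ≠ 0 := mul_ne_zero two_ne_zero (sub_ne_zero.mpr had.symm)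
    linear_combination (eq_div_iff hda).mp hReq
end

section
/- Let μ ∈ (0,1) and let γ > 0 satisfy the L₂ equilibrium condition (μ − 1 − γ) + (1−μ)/(1+γ)² + μ/γ² = 0. Then c₂ = (1/γ³)(μ + (1−μ)γ³/(1+γ)³) satisfies c₂ > 1; indeed c₂ = 1 + (1−μ)[(1/γ)(1 − 1/(1+γ)²) + 1/(1+γ)³]. -/
/-- If `γ > 0` satisfies the `L₂` equilibrium condition
`(μ − 1 − γ) + (1−μ)/(1+γ)² + μ/γ² = 0`, then the quadratic coefficient
`c₂ = (1/γ³)(μ + (1−μ)γ³/(1+γ)³)` satisfies `c₂ > 1`; indeed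
`c₂ = 1 + (1−μ)[(1/γ)(1 − 1/(1+γ)²) + 1/(1+γ)³]`. -/
theorem c2_gt_one_at_L2
    (μ γ : ℝ) (hμ : μ ∈ Set.Ioo (0 : ℝ) 1) (hγ : 0 < γ)
    (heq : (μ - 1 - γ) + (1 - μ) / (1 + γ) ^ 2 + μ / γ ^ 2 = 0) :
    1 < (1 / γ ^ 3) * (μ + (1 - μ) * γ ^ 3 / (1 + γ) ^ 3) ∧
    (1 / γ ^ 3) * (μ + (1 - μ) * γ ^ 3 / (1 + γ) ^ 3)
      = 1 + (1 - μ) * ((1 / γ) * (1 - 1 / (1 + γ) ^ 2) + 1 / (1 + γ) ^ 3) := by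
  have hγ₁ : 1 + γ ≠ 0 := by positivity
  have hc : (1 / γ ^ 3) * (μ + (1 - μ) * γ ^ 3 / (1 + γ) ^ 3)
      = 1 + (1 - μ) * ((1 / γ) * (1 - 1 / (1 + γ) ^ 2) + 1 / (1 + γ) ^ 3) := by
    have hdiff : (1 / γ ^ 3) * (μ + (1 - μ) * γ ^ 3 / (1 + γ) ^ 3)
        - (1 + (1 - μ) * ((1 / γ) * (1 - 1 / (1 + γ) ^ 2) + 1 / (1 + γ) ^ 3))
        = (1 / γ) * ((μ - 1 - γ) + (1 - μ) / (1 + γ) ^ 2 + μ / γ ^ 2) := by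
      field_simp
      ring
    rw [heq, mul_zero] at hdiff
    exact sub_eq_zero.mp hdiff
  refine ⟨?_, hc⟩
  rw [hc]
  have hμ₁ : 0 < 1 - μ := sub_pos.mpr hμ.2
  have hinv : 0 < 1 - 1 / (1 + γ) ^ 2 := by
    rw [sub_pos, div_lt_one (by positivity)]
    nlinarith
  exact lt_add_of_pos_right 1 (by positivity)
end
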